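/- (Key Lemma of Corollary 4.3.) Let s and b be facets with s contained in the closure of b, and let r ∈ R. If r takes a non-integral value on s (i.e. r(p) ∉ ℤ for some, equivalently every, p ∈ s), then the equality ⌊(b,r)⌋ = ⌈(s,r)⌉ cannot hold; that is, for every p ∈ s and q ∈ b one has ⌊r(q)⌋ ≠ ⌈r(p)⌉. -/

import Mathlib

open Set

/-- The set of affine roots `(r, n)` with `r ∈ R`, `n : ℤ`, vanishing at the point `x`,
i.e. such that `r x + n = 0`.  This is the set `Y_x`. -/
def affineRootsVanishingAt {V : Type*} [NormedAddCommGroup V] [NormedSpace ℝ V]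
    (R : Finset (V →ₗ[ℝ] ℝ)) (x : V) : Set ((V →ₗ[ℝ] ℝ) × ℤ) :=
  {α | α.1 ∈ R ∧ α.1 x + (α.2 : ℝ) = 0}

/-- `H_n`: the set of points where exactly `n` affine roots vanish. -/
def Hset {V : Type*} [NormedAddCommGroup V] [NormedSpace ℝ V]
    (R : Finset (V →ₗ[ℝ] ℝ)) (n : ℕ) : Set V :=
  {x | (affineRootsVanishingAt R x).ncard = n}

/-- A facet is a connected component of some `H_n`. -/
def IsFacet {V : Type*} [NormedAddCommGroup V] [NormedSpace ℝ V]
    (R : Finset (V →ₗ[ℝ] ℝ)) (σ : Set V) : Prop :=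
  ∃ (n : ℕ) (x : V), x ∈ Hset R n ∧ σ = connectedComponentIn (Hset R n) x

open Filter Topology

theorem affineRootsVanishingAt_finite {V : Type*} [NormedAddCommGroup V] [NormedSpace ℝ V]
    (R : Finset (V →ₗ[ℝ] ℝ)) (x : V) : (affineRootsVanishingAt R x).Finite := by
  refine Set.Finite.of_finite_image (f := Prod.fst) (R.finite_toSet.subset ?_) ?_
  · rintro _ ⟨α, hα, rfl⟩
    exact hα.1
  · rintro ⟨r, m⟩ ⟨-, h⟩ ⟨r', m'⟩ ⟨-, h'⟩ (rfl : r = r')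
    have : (m : ℝ) = m' := by simp only at h h'; linarith
    exact Prod.ext rfl (by exact_mod_cast this)

/-- Affine roots vanishing at a point close enough to `x` also vanish at `x`. -/
theorem eventually_affineRootsVanishingAt_subset {V : Type*} [NormedAddCommGroup V]
    [NormedSpace ℝ V] [FiniteDimensional ℝ V] (R : Finset (V →ₗ[ℝ] ℝ)) (x : V) :
    ∀ᶠ y in 𝓝 x, affineRootsVanishingAt R y ⊆ affineRootsVanishingAt R x := by
  have key : ∀ r ∈ R, ∀ᶠ y in 𝓝 x, ∀ m : ℤ, r y + m = 0 → r x + m = 0 := by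
    intro r _
    have hmem : Ioo ((⌈r x⌉ : ℝ) - 1) (⌊r x⌋ + 1) ∈ 𝓝 (r x) :=
      Ioo_mem_nhds (by linarith [Int.ceil_lt_add_one (r x)]) (Int.lt_floor_add_one _)
    filter_upwards [r.continuous_of_finiteDimensional.continuousAt hmem] with y hy m hm
    obtain ⟨h₁, h₂⟩ := hy
    have hy : r y = ((-m : ℤ) : ℝ) := by push_cast; linarith
    rw [hy] at h₁ h₂
    have h₁ : ⌈r x⌉ ≤ -m := by
      have : ⌈r x⌉ - 1 < -m := by exact_mod_cast h₁
      omega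
    have h₂ : -m ≤ ⌊r x⌋ := by
      have : -m < ⌊r x⌋ + 1 := by exact_mod_cast h₂
      omega
    rw [Int.ceil_le] at h₁
    rw [Int.le_floor] at h₂
    push_cast at h₁ h₂
    linarith
  filter_upwards [(Filter.eventually_all_finset R).2 key] with y hy α hα
  exact ⟨hα.1, hy α.1 hα.1 α.2 hα.2⟩

theorem IsFacet.isPreconnected {V : Type*} [NormedAddCommGroup V] [NormedSpace ℝ V]
    {R : Finset (V →ₗ[ℝ] ℝ)} {σ : Set V} (hσ : IsFacet R σ) : IsPreconnected σ := by
  obtain ⟨n, x, -, rfl⟩ := hσ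
  exact isPreconnected_connectedComponentIn

/-- The set of vanishing affine roots is constant on a facet. -/
theorem IsFacet.affineRootsVanishingAt_eq {V : Type*} [NormedAddCommGroup V] [NormedSpace ℝ V]
    [FiniteDimensional ℝ V] {R : Finset (V →ₗ[ℝ] ℝ)} {σ : Set V} (hσ : IsFacet R σ)
    {p q : V} (hp : p ∈ σ) (hq : q ∈ σ) :
    affineRootsVanishingAt R p = affineRootsVanishingAt R q := by
  have hconn := hσ.isPreconnected
  obtain ⟨n, x₀, -, rfl⟩ := hσ
  have hsub := connectedComponentIn_subset (Hset R n) x₀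
  refine hconn.induction₂ (fun x y => affineRootsVanishingAt R x = affineRootsVanishingAt R y)
    (fun x hx => ?_) (fun _ _ _ _ _ _ h h' => h.trans h') (fun _ _ _ _ h => h.symm) hp hq
  filter_upwards [self_mem_nhdsWithin,
    mem_nhdsWithin_of_mem_nhds (eventually_affineRootsVanishingAt_subset R x)] with y hy hyx
  have hcard : (affineRootsVanishingAt R x).ncard ≤ (affineRootsVanishingAt R y).ncard :=
    ((hsub hx).trans (hsub hy).symm).le
  exact (Set.eq_of_subset_of_ncard_le hyx hcard (affineRootsVanishingAt_finite R x)).symm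

/-- If a root is non-integral at one point of a facet, it is so on the whole facet. -/
theorem IsFacet.ne_intCast {V : Type*} [NormedAddCommGroup V] [NormedSpace ℝ V]
    [FiniteDimensional ℝ V] {R : Finset (V →ₗ[ℝ] ℝ)} {σ : Set V} (hσ : IsFacet R σ)
    {r : V →ₗ[ℝ] ℝ} (hr : r ∈ R) {p q : V} (hp : p ∈ σ) (hq : q ∈ σ)
    (h : ∀ m : ℤ, r p ≠ m) (m : ℤ) : r q ≠ m := by
  intro hm
  have hmem : (r, -m) ∈ affineRootsVanishingAt R q := ⟨hr, by simp [hm]⟩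
  rw [← hσ.affineRootsVanishingAt_eq hp hq] at hmem
  have := hmem.2
  push_cast at this
  exact h m (by linarith)

/-- A real function which is continuous and has no integral value on a preconnected set has
constant floor there. -/
theorem IsPreconnected.floor_eq {X : Type*} [TopologicalSpace X] {s : Set X}
    (hs : IsPreconnected s) {f : X → ℝ} (hf : ContinuousOn f s)
    (hint : ∀ x ∈ s, ∀ m : ℤ, f x ≠ m) {x y : X} (hx : x ∈ s) (hy : y ∈ s) :
    ⌊f x⌋ = ⌊f y⌋ := by
  have key : ∀ {x y : X}, x ∈ s → y ∈ s → ⌊f x⌋ ≤ ⌊f y⌋ := by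
    intro x y hx hy
    by_contra! hlt
    obtain ⟨z, hz, hzm⟩ := hs.intermediate_value hy hx hf
      ⟨(Int.floor_lt.1 hlt).le, Int.floor_le (f x)⟩
    exact hint z hz _ hzm
  exact le_antisymm (key hx hy) (key hy hx)

theorem floor_ne_ceil_of_nonintegral {V : Type*} [NormedAddCommGroup V] [NormedSpace ℝ V] [FiniteDimensional ℝ V]
    (R : Finset (V →ₗ[ℝ] ℝ)) (hR : ∀ r ∈ R, r ≠ 0)
    (s b : Set V) (hs : IsFacet R s) (hb : IsFacet R b) (hsb : s ⊆ closure b)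
    (r : V →ₗ[ℝ] ℝ) (hr : r ∈ R)
    (hnonint : ∃ p ∈ s, ∀ m : ℤ, r p ≠ m) :
    ∀ p ∈ s, ∀ q ∈ b, ⌊r q⌋ ≠ ⌈r p⌉ := by
  intro p hp q hq
  obtain ⟨p₀, hp₀, hp₀int⟩ := hnonint
  have hpint := hs.ne_intCast hr hp₀ hp hp₀int
  have hcont := r.continuous_of_finiteDimensional
  have hfloor : (⌊r p⌋ : ℝ) < r p := lt_of_le_of_ne (Int.floor_le _) (hpint _).symm
  obtain ⟨q', ⟨hq'₁, hq'₂⟩, hq'⟩ := mem_closure_iff_nhds.1 (hsb hp) _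
    (hcont.continuousAt (Ioo_mem_nhds hfloor (Int.lt_floor_add_one _)))
  have hq'int : ∀ m : ℤ, r q' ≠ m := by
    intro m hm
    rw [hm] at hq'₁ hq'₂
    have h₁ : ⌊r p⌋ < m := by exact_mod_cast hq'₁
    have h₂ : m < ⌊r p⌋ + 1 := by exact_mod_cast hq'₂
    omega
  have hqq' : ⌊r q⌋ = ⌊r q'⌋ := hb.isPreconnected.floor_eq hcont.continuousOn
    (fun x hx => hb.ne_intCast hr hq' hx hq'int) hq hq'
  have hq'p : ⌊r q'⌋ = ⌊r p⌋ := Int.floor_eq_iff.2 ⟨hq'₁.le, hq'₂⟩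
  rw [hqq', hq'p]
  exact (Int.lt_ceil.2 hfloor).ne
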